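/- Let α and β both be negative integers with -α-β ≤ n. Then for every h with -β ≤ h ≤ n+α and all real x, the Bernstein polynomial satisfies B_h^n(x) = Σ_{i=-α-β}^{n} C(n+α+β, h+β)^{-1} C(n,h) b_{h+β, i+α+β}^{(n+α+β, -α, -β)} Ĵ_i^{(α,β)}(x), where Ĵ_i^{(α,β)}(x) := (1-x)^{-α} x^{-β} R_{i+α+β}^{(-α,-β)}(x). -/

import Mathlib

open Finset

/-- Pochhammer symbol `(x)_m = x (x+1) ⋯ (x+m-1)`. -/
noncomputable def poch (x : ℝ) (m : ℕ) : ℝ := ∏ j ∈ Finset.range m, (x + j)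

/-- Bernstein polynomial `B_j^n(x) = C(n,j) x^j (1-x)^(n-j)`. -/
noncomputable def bern (n j : ℕ) (x : ℝ) : ℝ := (n.choose j : ℝ) * x ^ j * (1 - x) ^ (n - j)

/-- Shifted Jacobi polynomial `R_i^(a,b)(x)`. -/
noncomputable def shiftedJacobi (a b : ℝ) (i : ℕ) (x : ℝ) : ℝ :=
  poch (a + 1) i / (Nat.factorial i : ℝ) *
    ∑ j ∈ Finset.range (i + 1),
      poch (-(i : ℝ)) j * poch ((i : ℝ) + a + b + 1) j /
        ((Nat.factorial j : ℝ) * poch (a + 1) j) * (1 - x) ^ j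

/-- Hahn polynomial `Q_m(t; a, b, N)`. -/
noncomputable def hahnQ (m : ℕ) (t : ℝ) (a b : ℝ) (N : ℕ) : ℝ :=
  ∑ j ∈ Finset.range (m + 1),
    poch (-(m : ℝ)) j * poch ((m : ℝ) + a + b + 1) j * poch (-t) j /
      ((Nat.factorial j : ℝ) * poch (a + 1) j * poch (-(N : ℝ)) j)

/-- Dual Hahn polynomial `R_m(λ(t); a, b, N)` with `λ(t) = t(t+a+b+1)`. -/
noncomputable def dualHahnR (m : ℕ) (t : ℝ) (a b : ℝ) (N : ℕ) : ℝ :=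
  ∑ j ∈ Finset.range (m + 1),
    poch (-(m : ℝ)) j * poch (t + a + b + 1) j * poch (-t) j /
      ((Nat.factorial j : ℝ) * poch (a + 1) j * poch (-(N : ℝ)) j)

/-- Modified Jacobi polynomial `J_{i,k,l}^(α,β)(x) = (1-x)^l x^k R_{i-k-l}^(α+2l,β+2k)(x)`. -/
noncomputable def modJacobi (α β : ℝ) (k l i : ℕ) (x : ℝ) : ℝ :=
  (1 - x) ^ l * x ^ k * shiftedJacobi (α + 2 * l) (β + 2 * k) (i - k - l) x

/-- Connection coefficient `c_{ih}` of the Bernstein form of the modified Jacobi polynomials. -/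
noncomputable def cCoef (α β : ℝ) (n k l i h : ℕ) : ℝ :=
  poch (α + 2 * l + 1) (i - k - l) / (Nat.factorial (i - k - l) : ℝ) *
    (n.choose h : ℝ)⁻¹ * ((n - k - l).choose (h - k) : ℝ) *
    hahnQ (i - k - l) ((n : ℝ) - l - h) (α + 2 * l) (β + 2 * k) (n - k - l)

/-- The quantity `z_{hi}`. -/
noncomputable def zCoef (α β : ℝ) (n k l h i : ℕ) : ℝ :=
  (n.choose h : ℝ) * (2 * (i : ℝ) + (α + β + 1)) * poch ((k : ℝ) + l - n) (i - k - l) *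
      poch (α + 2 * l + 1) (n - l - h) * poch (β + 2 * k + 1) (h - k) /
    (poch (α + 2 * l + 1) (i - k - l) * poch ((i : ℝ) + k + l + (α + β + 1)) (n + 1 - k - l))

/-- The quantity `w_{hi}`. -/
noncomputable def wCoef (α β : ℝ) (n k l h i : ℕ) : ℝ :=
  hahnQ (i - k - l) ((h : ℝ) - k) (β + 2 * k) (α + 2 * l) (n - k - l)

/-- Connection coefficient `d_{hi}` of the modified Jacobi form of Bernstein polynomials. -/
noncomputable def dCoef (α β : ℝ) (n k l h i : ℕ) : ℝ := zCoef α β n k l h i * wCoef α β n k l h i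

/-- Coefficient `a_{ih}^(m,a,b) = (-1)^i ((b+1)_i / i!) Q_i(h; b, a, m)`. -/
noncomputable def aCoef (m : ℕ) (a b : ℝ) (i h : ℕ) : ℝ :=
  (-1 : ℝ) ^ i * poch (b + 1) i / (Nat.factorial i : ℝ) * hahnQ i (h : ℝ) b a m

/-- Coefficient `b_{hi}^(m,a,b)`. -/
noncomputable def bCoef (m : ℕ) (a b : ℝ) (h i : ℕ) : ℝ :=
  (m.choose h : ℝ) * (2 * (i : ℝ) + a + b + 1) * poch (-(m : ℝ)) i * poch (a + 1) (m - h) *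
      poch (b + 1) h / (poch (a + 1) i * poch ((i : ℝ) + a + b + 1) (m + 1)) *
    hahnQ i (h : ℝ) b a m

lemma poch_zero (x : ℝ) : poch x 0 = 1 := by simp [poch]

lemma poch_succ (x : ℝ) (m : ℕ) : poch x (m + 1) = poch x m * (x + m) := by
  simp [poch, Finset.prod_range_succ]

lemma poch_succ_left (x : ℝ) (m : ℕ) : poch x (m + 1) = x * poch (x + 1) m := by
  simp only [poch, Finset.prod_range_succ', Nat.cast_zero, add_zero, Nat.cast_succ]
  rw [mul_comm]
  congr 1
  exact Finset.prod_congr rfl fun j _ => by ring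

lemma mul_poch_add_one (x : ℝ) (m : ℕ) : x * poch (x + 1) m = poch x m * (x + m) := by
  rw [← poch_succ_left, poch_succ]

lemma poch_pos {x : ℝ} (hx : 0 < x) (m : ℕ) : 0 < poch x m :=
  Finset.prod_pos fun j _ => by positivity

lemma poch_neg_eq_zero {k j : ℕ} (h : k < j) : poch (-(k : ℝ)) j = 0 :=
  Finset.prod_eq_zero (Finset.mem_range.2 h) (by simp)

lemma poch_neg_ne_zero {k j : ℕ} (h : j ≤ k) : poch (-(k : ℝ)) j ≠ 0 := by
  refine Finset.prod_ne_zero_iff.2 fun l hl => ?_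
  have : (l : ℝ) < k := by exact_mod_cast (Finset.mem_range.1 hl).trans_le h
  linarith

lemma poch_neg_self_sq (m : ℕ) : poch (-(m : ℝ)) m * poch (-(m : ℝ)) m = (m.factorial : ℝ) ^ 2 := by
  induction m with
  | zero => simp [poch_zero]
  | succ m ih =>
    rw [poch_succ_left, show -((m + 1 : ℕ) : ℝ) + 1 = -(m : ℝ) by push_cast; ring,
      Nat.factorial_succ]
    push_cast
    linear_combination ((m : ℝ) + 1) ^ 2 * ih

/-- The summand of the Hahn polynomial `hahnQ i t b a N`. -/
noncomputable def hahnTerm (i : ℕ) (t b a : ℝ) (N j : ℕ) : ℝ :=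
  poch (-(i : ℝ)) j * poch ((i : ℝ) + b + a + 1) j * poch (-t) j /
    ((Nat.factorial j : ℝ) * poch (b + 1) j * poch (-(N : ℝ)) j)

lemma hahnTerm_partial_sum {a b h : ℝ} (hb : 0 ≤ b) (hh : 0 ≤ h) (m i k : ℕ) (hk : k ≤ m + 1) :
    ∑ j ∈ Finset.range k,
      (((m : ℝ) + 1) * ((a + 1 + m - h) * hahnTerm i h b a (m + 1) j +
          (b + 1 + h) * hahnTerm i (h + 1) b a (m + 1) j) -
        ((m : ℝ) + 1 - i) * (m + 1 + i + (a + b + 1)) * hahnTerm i h b a m j) =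
      -((m : ℝ) + 1) * (k * (b + k) / (h + 1)) * hahnTerm i (h + 1) b a (m + 1) k := by
  induction k with
  | zero => simp
  | succ k ih =>
    rw [Finset.sum_range_succ, ih (by omega)]
    have hkm : (k : ℝ) ≤ m := by exact_mod_cast (by omega : k ≤ m)
    have h1 : (m : ℝ) + 1 - k ≠ 0 := by linarith
    have h2 : (m : ℝ) + 1 ≠ 0 := by positivity
    have h3 : h + 1 ≠ 0 := by positivity
    have h4 : b + 1 + k ≠ 0 := by positivity
    have h5 : poch (b + 1) k ≠ 0 := (poch_pos (by positivity) k).ne'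
    have h6 : poch (-((m : ℝ) + 1)) k ≠ 0 := by
      have := poch_neg_ne_zero (show k ≤ m + 1 by omega)
      push_cast at this
      exact this
    have h7 : (k.factorial : ℝ) ≠ 0 := by positivity
    have h8 : (k : ℝ) + 1 ≠ 0 := by positivity
    have e1 : poch (-h) k = poch (-(h + 1)) k * (h + 1 - k) / (h + 1) := by
      have := mul_poch_add_one (-(h + 1)) k
      rw [show -(h + 1) + 1 = -h by ring] at this
      rw [eq_div_iff h3]
      linear_combination -this
    have e2 : poch (-(m : ℝ)) k = poch (-((m : ℝ) + 1)) k * (m + 1 - k) / (m + 1) := by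
      have := mul_poch_add_one (-((m : ℝ) + 1)) k
      rw [show -((m : ℝ) + 1) + 1 = -(m : ℝ) by ring] at this
      rw [eq_div_iff h2]
      linear_combination -this
    simp only [hahnTerm, poch_succ, Nat.factorial_succ]
    push_cast
    rw [e1, e2]
    generalize poch (-(h + 1)) k = W at *
    generalize poch (-((m : ℝ) + 1)) k = D at *
    generalize poch (b + 1) k = E at *
    generalize poch (-(i : ℝ)) k = P
    generalize poch ((i : ℝ) + b + a + 1) k = q
    generalize (k.factorial : ℝ) = f at *
    rw [show -((m : ℝ) + 1) + k = -((m : ℝ) + 1 - k) by ring]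
    field_simp
    ring

lemma hahnQ_elevation {a b : ℝ} (hb : 0 ≤ b) {m i h : ℕ} (hh : h ≤ m) (hi : i ≤ m + 1) :
    ((m : ℝ) + 1) * ((a + 1 + m - h) * hahnQ i h b a (m + 1) +
        (b + 1 + h) * hahnQ i ((h + 1 : ℕ) : ℝ) b a (m + 1)) =
      ((m : ℝ) + 1 - i) * (m + 1 + i + (a + b + 1)) * hahnQ i h b a m := by
  have key := hahnTerm_partial_sum (a := a) hb (Nat.cast_nonneg (α := ℝ) h) m i
  have hQ : ∀ t N, hahnQ i t b a N = ∑ j ∈ Finset.range (i + 1), hahnTerm i t b a N j :=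
    fun _ _ => rfl
  rw [← sub_eq_zero, hQ, hQ, hQ]
  have : ∀ f g e : ℕ → ℝ, ∀ c c1 c2 d : ℝ,
      c * (c1 * ∑ j ∈ Finset.range (i + 1), f j + c2 * ∑ j ∈ Finset.range (i + 1), g j)
        - d * ∑ j ∈ Finset.range (i + 1), e j
      = ∑ j ∈ Finset.range (i + 1), (c * (c1 * f j + c2 * g j) - d * e j) := by
    intro f g e c c1 c2 d
    simp only [Finset.mul_sum, ← Finset.sum_add_distrib, ← Finset.sum_sub_distrib]
  rw [this]
  push_cast
  rcases Nat.lt_or_ge m i with hmi | hmi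
  · obtain rfl : i = m + 1 := by omega
    rw [Finset.sum_range_succ, key (m + 1) le_rfl]
    have hz : hahnTerm (m + 1) h b a (m + 1) (m + 1) = 0 := by
      simp [hahnTerm, poch_neg_eq_zero (show h < m + 1 by omega)]
    rw [hz]
    have hh1 : (h : ℝ) + 1 ≠ 0 := by positivity
    have hcase : ((h : ℝ) - m) * hahnTerm (m + 1) ((h : ℝ) + 1) b a (m + 1) (m + 1) = 0 := by
      rcases hh.eq_or_lt with rfl | hlt
      · simp
      · have := poch_neg_eq_zero (show h + 1 < m + 1 by omega)
        push_cast at this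
        rw [hahnTerm, this]
        simp
    push_cast
    field_simp
    linear_combination (((m : ℝ) + 1) * (h + b + m + 2)) * hcase
  · rw [key (i + 1) (by omega)]
    simp [hahnTerm, poch_neg_eq_zero (Nat.lt_succ_self i)]

lemma choose_succ_mul_sub {m h : ℕ} (hh : h ≤ m) :
    ((m + 1).choose h : ℝ) * (m + 1 - h) = (m + 1) * (m.choose h : ℝ) := by
  have := Nat.add_one_mul_choose_eq m h
  have h2 := Nat.choose_succ_right_eq (m + 1) h
  have h3 : (((m + 1 - h : ℕ)) : ℝ) = m + 1 - h := by
    rw [Nat.cast_sub (by omega)]; push_cast; ring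
  rw [← h3]
  exact_mod_cast (h2.symm.trans this.symm)

lemma choose_succ_succ_mul (m h : ℕ) :
    ((m + 1).choose (h + 1) : ℝ) * (h + 1) = (m + 1) * (m.choose h : ℝ) := by
  exact_mod_cast (Nat.add_one_mul_choose_eq m h).symm

lemma bCoef_elevation {a b : ℝ} (ha : 0 ≤ a) (hb : 0 ≤ b) {m i h : ℕ} (hh : h ≤ m)
    (hi : i ≤ m + 1) :
    ((m : ℝ) + 1 - h) * bCoef (m + 1) a b h i + ((h : ℝ) + 1) * bCoef (m + 1) a b (h + 1) i =
      ((m : ℝ) + 1) * bCoef m a b h i := by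
  have hQ := hahnQ_elevation (a := a) hb hh hi
  have c1 := choose_succ_mul_sub hh
  have c2 := choose_succ_succ_mul m h
  have hs : 0 < a + 1 := by positivity
  have h1 : poch (a + 1) i ≠ 0 := (poch_pos hs i).ne'
  have hp : 0 < (i : ℝ) + a + b + 1 := by positivity
  have h2 : poch ((i : ℝ) + a + b + 1) (m + 1) ≠ 0 := (poch_pos hp _).ne'
  have h3 : (i : ℝ) + a + b + 1 + (m + 1 : ℕ) ≠ 0 := by positivity
  have e1 : poch (-((m + 1 : ℕ) : ℝ)) i * (m + 1 - i) = (m + 1) * poch (-(m : ℝ)) i := by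
    have := mul_poch_add_one (-((m + 1 : ℕ) : ℝ)) i
    rw [show -((m + 1 : ℕ) : ℝ) + 1 = -(m : ℝ) by push_cast; ring] at this
    push_cast at this ⊢
    linear_combination this
  have e2 : poch (a + 1) (m + 1 - h) = poch (a + 1) (m - h) * (a + 1 + m - h) := by
    rw [show m + 1 - h = (m - h) + 1 by omega, poch_succ, Nat.cast_sub hh]
    ring
  have hm : (m : ℝ) + 1 ≠ 0 := by positivity
  unfold bCoef
  rw [show m + 1 - (h + 1) = m - h by omega, e2, poch_succ (b + 1), poch_succ _ (m + 1)]
  generalize hahnQ i ((h + 1 : ℕ) : ℝ) b a (m + 1) = Q1 at *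
  generalize hahnQ i h b a (m + 1) = Q0 at *
  generalize hahnQ i h b a m = Q at *
  generalize poch (-((m + 1 : ℕ) : ℝ)) i = p1 at *
  generalize poch (-(m : ℝ)) i = p0 at *
  generalize poch ((i : ℝ) + a + b + 1) (m + 1) = D at *
  generalize poch (a + 1) i = E at *
  generalize poch (a + 1) (m - h) = F at *
  generalize poch (b + 1) h = G at *
  generalize ((m + 1).choose h : ℝ) = C0 at *
  generalize ((m + 1).choose (h + 1) : ℝ) = C1 at *
  generalize (m.choose h : ℝ) = C at *
  have key : p1 * ((a + 1 + m - h) * Q0 + (b + 1 + h) * Q1) =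
      (i + a + b + 1 + (m + 1 : ℕ)) * p0 * Q := by
    apply mul_left_cancel₀ hm
    push_cast
    linear_combination p1 * hQ + (m + 1 + i + (a + b + 1)) * Q * e1
  have lhs : ((m : ℝ) + 1 - h) * (C0 * (2 * i + a + b + 1) * p1 * (F * (a + 1 + m - h)) * G /
        (E * (D * (i + a + b + 1 + (m + 1 : ℕ)))) * Q0) +
      (h + 1) * (C1 * (2 * i + a + b + 1) * p1 * F * (G * (b + 1 + h)) /
        (E * (D * (i + a + b + 1 + (m + 1 : ℕ)))) * Q1) =
      (m + 1) * C * (2 * i + a + b + 1) * F * G /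
        (E * (D * (i + a + b + 1 + (m + 1 : ℕ)))) *
        (p1 * ((a + 1 + m - h) * Q0 + (b + 1 + h) * Q1)) := by
    generalize E * (D * (i + a + b + 1 + (m + 1 : ℕ))) = Z
    linear_combination ((2 * i + a + b + 1) * p1 * F * G / Z) *
      ((a + 1 + m - h) * Q0 * c1 + (b + 1 + h) * Q1 * c2)
  rw [lhs, key]
  field_simp

lemma bern_elevation {m h : ℕ} (hh : h ≤ m) (x : ℝ) :
    ((m : ℝ) + 1 - h) * bern (m + 1) h x + ((h : ℝ) + 1) * bern (m + 1) (h + 1) x =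
      ((m : ℝ) + 1) * bern m h x := by
  have c1 := choose_succ_mul_sub hh
  have c2 := choose_succ_succ_mul m h
  unfold bern
  rw [show m + 1 - (h + 1) = m - h by omega, show m + 1 - h = (m - h) + 1 by omega, pow_succ,
    pow_succ]
  linear_combination x ^ h * (1 - x) ^ (m - h) * ((1 - x) * c1 + x * c2)

/-- Telescoping partial sums behind the expansion of powers in Jacobi polynomials. -/
lemma jacobi_inversion_partial_sum {s : ℝ} (hs : 0 < s) (m j k : ℕ) :
    ((m : ℝ) - j) * ∑ i ∈ Finset.range k,
      (2 * (i : ℝ) + s) * poch (-(m : ℝ)) i * poch (-(i : ℝ)) j * poch ((i : ℝ) + s) j /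
        ((Nat.factorial i : ℝ) * poch ((i : ℝ) + s) (m + 1)) =
      -(poch (-(m : ℝ)) k * ((k : ℝ) - j) * poch (-(k : ℝ)) j * poch ((k : ℝ) + s) j /
        ((Nat.factorial k : ℝ) * poch ((k : ℝ) + s) m)) := by
  induction k with
  | zero =>
    rcases j.eq_zero_or_pos with rfl | hj
    · simp
    · simp [show poch 0 j = 0 by simpa using poch_neg_eq_zero hj]
  | succ k ih =>
    rw [Finset.sum_range_succ, mul_add, ih]
    have h0 : 0 < (k : ℝ) + s := by positivity
    have h1 : (k : ℝ) + s ≠ 0 := h0.ne'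
    have h2 : (k : ℝ) + s + m ≠ 0 := by positivity
    have h3 : poch ((k : ℝ) + s) m ≠ 0 := (poch_pos h0 m).ne'
    have h4 : (k.factorial : ℝ) ≠ 0 := by positivity
    have h5 : (k : ℝ) + 1 ≠ 0 := by positivity
    have e1 : ((k : ℝ) + 1 - j) * poch (-((k + 1 : ℕ) : ℝ)) j = (k + 1) * poch (-(k : ℝ)) j := by
      have := mul_poch_add_one (-((k + 1 : ℕ) : ℝ)) j
      rw [show -((k + 1 : ℕ) : ℝ) + 1 = -(k : ℝ) by push_cast; ring] at this
      push_cast at this ⊢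
      linear_combination this
    have e2 : ∀ l, poch (((k + 1 : ℕ) : ℝ) + s) l = poch ((k : ℝ) + s) l * (k + s + l) / (k + s) := by
      intro l
      have := mul_poch_add_one ((k : ℝ) + s) l
      rw [show (k : ℝ) + s + 1 = ((k + 1 : ℕ) : ℝ) + s by push_cast; ring] at this
      rw [eq_div_iff h1]
      linear_combination this
    rw [e2, e2, poch_succ _ k, poch_succ _ m, Nat.factorial_succ]
    rw [show poch (-(m : ℝ)) k * (-(m : ℝ) + k) * (((k + 1 : ℕ) : ℝ) - j) *
        poch (-((k + 1 : ℕ) : ℝ)) j = poch (-(m : ℝ)) k * (-(m : ℝ) + k) *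
        ((k + 1) * poch (-(k : ℝ)) j) by rw [← e1]; push_cast; ring]
    push_cast
    generalize poch (-(m : ℝ)) k = P
    generalize poch (-(k : ℝ)) j = q
    generalize poch ((k : ℝ) + s) j = r
    generalize poch ((k : ℝ) + s) m = D at *
    generalize (k.factorial : ℝ) = f at *
    field_simp
    ring

lemma jacobi_inversion {s : ℝ} (hs : 0 < s) {m j : ℕ} (hj : j ≤ m) :
    ∑ i ∈ Finset.range (m + 1),
      (2 * (i : ℝ) + s) * poch (-(m : ℝ)) i * poch (-(i : ℝ)) j * poch ((i : ℝ) + s) j /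
        ((Nat.factorial i : ℝ) * poch ((i : ℝ) + s) (m + 1)) =
      if j = m then (m.factorial : ℝ) else 0 := by
  split_ifs with hjm
  · subst hjm
    rw [Finset.sum_range_succ, Finset.sum_eq_zero, zero_add, poch_succ]
    · have h0 : 0 < (j : ℝ) + s := by positivity
      have h1 : poch ((j : ℝ) + s) j ≠ 0 := (poch_pos h0 j).ne'
      have h2 : (j.factorial : ℝ) ≠ 0 := by positivity
      have h3 : (j : ℝ) + s + j ≠ 0 := by positivity
      field_simp
      linear_combination (2 * (j : ℝ) + s) * poch_neg_self_sq j
    · intro i hi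
      simp [poch_neg_eq_zero (Finset.mem_range.1 hi)]
  · have h := jacobi_inversion_partial_sum hs m j (m + 1)
    rw [poch_neg_eq_zero (Nat.lt_succ_self m)] at h
    have : (m : ℝ) - j ≠ 0 := sub_ne_zero.2 (Nat.cast_injective.ne (Ne.symm hjm))
    simpa [this] using h

lemma one_sub_pow_eq_sum_shiftedJacobi {a b : ℝ} (ha : 0 ≤ a) (hb : 0 ≤ b) (m : ℕ) (x : ℝ) :
    (1 - x) ^ m = ∑ i ∈ Finset.range (m + 1), bCoef m a b 0 i * shiftedJacobi a b i x := by
  have hs : 0 < a + b + 1 := by positivity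
  have ha1 : 0 < a + 1 := by positivity
  have hterm : ∀ i ∈ Finset.range (m + 1), bCoef m a b 0 i * shiftedJacobi a b i x =
      ∑ j ∈ Finset.range (m + 1), (poch (a + 1) m / (j.factorial * poch (a + 1) j) * (1 - x) ^ j) *
        ((2 * (i : ℝ) + (a + b + 1)) * poch (-(m : ℝ)) i * poch (-(i : ℝ)) j *
          poch ((i : ℝ) + (a + b + 1)) j /
        ((Nat.factorial i : ℝ) * poch ((i : ℝ) + (a + b + 1)) (m + 1))) := by
    intro i hi
    have hi' : i + 1 ≤ m + 1 := by simpa using Finset.mem_range.1 hi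
    have hQ : hahnQ i ((0 : ℕ) : ℝ) b a m = 1 := by
      rw [hahnQ, Finset.sum_range_succ', Finset.sum_eq_zero]
      · simp [poch_zero]
      · intro j _
        simp [show poch 0 (j + 1) = 0 by simpa using poch_neg_eq_zero (Nat.succ_pos j)]
    rw [← Finset.sum_subset (Finset.range_subset_range.2 hi')]
    · rw [bCoef, shiftedJacobi, hQ, ← mul_assoc, Finset.mul_sum]
      refine Finset.sum_congr rfl fun j _ => ?_
      rw [show (i : ℝ) + a + b + 1 = i + (a + b + 1) by ring]
      have h1 : poch (a + 1) i ≠ 0 := (poch_pos ha1 i).ne'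
      have h2 : poch (a + 1) j ≠ 0 := (poch_pos ha1 j).ne'
      have h3 : poch ((i : ℝ) + (a + b + 1)) (m + 1) ≠ 0 :=
        (poch_pos (by positivity) _).ne'
      simp only [poch_zero, Nat.choose_zero_right, Nat.sub_zero, Nat.cast_one]
      field_simp
      ring
    · intro j _ hj
      have : i < j := by simpa using hj
      simp [poch_neg_eq_zero this]
  rw [Finset.sum_congr rfl hterm, Finset.sum_comm]
  have hinner : ∀ j ∈ Finset.range (m + 1), ∑ i ∈ Finset.range (m + 1),
      (poch (a + 1) m / (j.factorial * poch (a + 1) j) * (1 - x) ^ j) *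
        ((2 * (i : ℝ) + (a + b + 1)) * poch (-(m : ℝ)) i * poch (-(i : ℝ)) j *
          poch ((i : ℝ) + (a + b + 1)) j /
        ((Nat.factorial i : ℝ) * poch ((i : ℝ) + (a + b + 1)) (m + 1))) =
      if j = m then (1 - x) ^ m else 0 := by
    intro j hj
    rw [← Finset.mul_sum, jacobi_inversion hs (Nat.lt_succ_iff.1 (Finset.mem_range.1 hj))]
    split_ifs with hjm
    · subst hjm
      have h2 : poch (a + 1) j ≠ 0 := (poch_pos ha1 j).ne'
      have h4 : (j.factorial : ℝ) ≠ 0 := by positivity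
      field_simp
    · simp
  rw [Finset.sum_congr rfl hinner]
  simp

/-- Jacobi form of the Bernstein polynomials. -/
lemma bern_eq_sum_shiftedJacobi {a b : ℝ} (ha : 0 ≤ a) (hb : 0 ≤ b) (x : ℝ) (m h : ℕ)
    (hh : h ≤ m) :
    bern m h x = ∑ i ∈ Finset.range (m + 1), bCoef m a b h i * shiftedJacobi a b i x := by
  induction m generalizing h with
  | zero =>
    obtain rfl : h = 0 := by omega
    simpa [bern] using one_sub_pow_eq_sum_shiftedJacobi ha hb 0 x
  | succ m ihm =>
    induction h with
    | zero =>
      rw [← one_sub_pow_eq_sum_shiftedJacobi ha hb]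
      simp [bern]
    | succ h ihh =>
      have hhm : h ≤ m := by omega
      have hpos : (h : ℝ) + 1 ≠ 0 := by positivity
      apply mul_left_cancel₀ hpos
      have hlast : bCoef m a b h (m + 1) = 0 := by
        simp [bCoef, poch_neg_eq_zero (Nat.lt_succ_self m)]
      have hm : bern m h x =
          ∑ i ∈ Finset.range (m + 1 + 1), bCoef m a b h i * shiftedJacobi a b i x := by
        rw [Finset.sum_range_succ, hlast, zero_mul, add_zero, ihm h hhm]
      have hel := bern_elevation hhm x
      rw [hm, ihh (by omega)] at hel
      have hsum : ((m : ℝ) + 1 - h) * ∑ i ∈ Finset.range (m + 1 + 1),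
            bCoef (m + 1) a b h i * shiftedJacobi a b i x +
          ((h : ℝ) + 1) * ∑ i ∈ Finset.range (m + 1 + 1),
            bCoef (m + 1) a b (h + 1) i * shiftedJacobi a b i x =
          ((m : ℝ) + 1) * ∑ i ∈ Finset.range (m + 1 + 1),
            bCoef m a b h i * shiftedJacobi a b i x := by
        simp only [Finset.mul_sum, ← Finset.sum_add_distrib]
        refine Finset.sum_congr rfl fun i hi => ?_
        have := bCoef_elevation ha hb hhm (Nat.lt_succ_iff.1 (Finset.mem_range.1 hi))
        linear_combination shiftedJacobi a b i x * this
      linear_combination hel - hsum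

/-- Generalized Jacobi polynomials, case `α, β ∈ ℤ⁻`: generalized Jacobi form of the
Bernstein polynomials. -/
theorem bernstein_genJacobi_form_neg_both (n : ℕ) (α β : ℤ) (hα : α < 0) (hβ : β < 0)
    (hαβn : -α - β ≤ (n : ℤ)) :
    ∀ h : ℕ, -β ≤ (h : ℤ) → (h : ℤ) ≤ (n : ℤ) + α → ∀ x : ℝ,
      bern n h x =
        ∑ i ∈ Finset.Icc (-α - β).toNat n,
          (((n : ℤ) + α + β).toNat.choose ((h : ℤ) + β).toNat : ℝ)⁻¹ * (n.choose h : ℝ) *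
            bCoef ((n : ℤ) + α + β).toNat ((-α : ℤ) : ℝ) ((-β : ℤ) : ℝ)
              ((h : ℤ) + β).toNat ((i : ℤ) + α + β).toNat *
            ((1 - x) ^ (-α).toNat * x ^ (-β).toNat *
              shiftedJacobi ((-α : ℤ) : ℝ) ((-β : ℤ) : ℝ) ((i : ℤ) + α + β).toNat x) := by
  intro h hβh hhn x
  obtain ⟨A, rfl⟩ : ∃ A : ℕ, α = -(A : ℤ) := ⟨(-α).toNat, by omega⟩
  obtain ⟨B, rfl⟩ : ∃ B : ℕ, β = -(B : ℤ) := ⟨(-β).toNat, by omega⟩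
  obtain ⟨m, rfl⟩ : ∃ m : ℕ, n = m + (A + B) := ⟨n - (A + B), by omega⟩
  obtain ⟨H, rfl⟩ : ∃ H : ℕ, h = H + B := ⟨h - B, by omega⟩
  have hH : H ≤ m := by omega
  have hset : Finset.Icc (- -(A : ℤ) - -(B : ℤ)).toNat (m + (A + B)) =
      Finset.Ico (0 + (A + B)) (m + 1 + (A + B)) := by
    ext i
    simp only [Finset.mem_Icc, Finset.mem_Ico]
    omega
  rw [hset, ← Finset.sum_Ico_add', ← Finset.range_eq_Ico]
  have t1 : (((m + (A + B) : ℕ) : ℤ) + -(A : ℤ) + -(B : ℤ)).toNat = m := by omega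
  have t2 : (((H + B : ℕ) : ℤ) + -(B : ℤ)).toNat = H := by omega
  have t3 : ∀ i : ℕ, (((i + (A + B) : ℕ) : ℤ) + -(A : ℤ) + -(B : ℤ)).toNat = i := by
    intro i; omega
  simp only [t1, t2, t3, neg_neg, Int.toNat_natCast, Int.cast_natCast]
  have hC : (m.choose H : ℝ) ≠ 0 := by exact_mod_cast (Nat.choose_pos hH).ne'
  have hb := bern_eq_sum_shiftedJacobi (Nat.cast_nonneg (α := ℝ) A) (Nat.cast_nonneg (α := ℝ) B)
    x m H hH
  calc bern (m + (A + B)) (H + B) x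
      = (m.choose H : ℝ)⁻¹ * ((m + (A + B)).choose (H + B) : ℝ) * ((1 - x) ^ A * x ^ B) *
          bern m H x := by
        rw [bern, bern, show m + (A + B) - (H + B) = (m - H) + A by omega, pow_add, pow_add]
        field_simp
    _ = _ := by
        rw [hb, Finset.mul_sum]
        exact Finset.sum_congr rfl fun i _ => by ring
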